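/- Let g be the standard symmetric bilinear form of index k on ℝⁿ with 0 < k < n (given by the block matrix diag(−I_k, I_{n−k})), and let G_k⁻(n) be the set of k-dimensional subspaces of ℝⁿ on which g is negative definite. Then the identity component of the isometry group O(n,k) acts transitively on G_k⁻(n); in particular, G_k⁻(n) is path-connected. -/

import Mathlib

open scoped Matrix

/-- The standard symmetric bilinear form of index `k` on `ℝⁿ`,
`g(x,y) = −Σ_{i<k} xᵢyᵢ + Σ_{i≥k} xᵢyᵢ`. -/
def stdForm (n k : ℕ) (x y : Fin n → ℝ) : ℝ :=
  ∑ i : Fin n, (if (i : ℕ) < k then (-1 : ℝ) else 1) * x i * y i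

/-- The isometry group `O(n,k)` of the standard form of index `k`, as a set of matrices. -/
def indefOrthogonalGroup (n k : ℕ) : Set (Matrix (Fin n) (Fin n) ℝ) :=
  {A | ∀ x y : Fin n → ℝ, stdForm n k (A.mulVec x) (A.mulVec y) = stdForm n k x y}

/-- The Grassmannian `G_k⁻(n)` of `k`-dimensional subspaces of `ℝⁿ` on which the standard
form of index `k` is negative definite. -/
def negGrassmannian (n k : ℕ) : Set (Submodule ℝ (Fin n → ℝ)) :=
  {S | Module.finrank ℝ S = k ∧ ∀ x ∈ S, x ≠ 0 → stdForm n k x x < 0}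


theorem sf_add_left (n k : ℕ) (x y z : Fin n → ℝ) :
    stdForm n k (x + y) z = stdForm n k x z + stdForm n k y z := by
  simp only [stdForm, ← Finset.sum_add_distrib, Pi.add_apply]
  exact Finset.sum_congr rfl fun i _ => by ring

theorem sf_smul_left (n k : ℕ) (c : ℝ) (x z : Fin n → ℝ) :
    stdForm n k (c • x) z = c * stdForm n k x z := by
  simp only [stdForm, Finset.mul_sum, Pi.smul_apply, smul_eq_mul]
  exact Finset.sum_congr rfl fun i _ => by ring

theorem sf_comm (n k : ℕ) (x z : Fin n → ℝ) :
    stdForm n k x z = stdForm n k z x := by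
  simp only [stdForm]
  exact Finset.sum_congr rfl fun i _ => by ring

theorem sf_add_right (n k : ℕ) (x y z : Fin n → ℝ) :
    stdForm n k z (x + y) = stdForm n k z x + stdForm n k z y := by
  rw [sf_comm, sf_add_left, sf_comm n k x, sf_comm n k y]

theorem sf_smul_right (n k : ℕ) (c : ℝ) (x z : Fin n → ℝ) :
    stdForm n k z (c • x) = c * stdForm n k z x := by
  rw [sf_comm, sf_smul_left, sf_comm]

theorem sf_sub_left (n k : ℕ) (x y z : Fin n → ℝ) :
    stdForm n k (x - y) z = stdForm n k x z - stdForm n k y z := by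
  have : x - y = x + (-1 : ℝ) • y := by simp [sub_eq_add_neg]
  rw [this, sf_add_left, sf_smul_left]; ring

theorem sf_sub_right (n k : ℕ) (x y z : Fin n → ℝ) :
    stdForm n k z (x - y) = stdForm n k z x - stdForm n k z y := by
  rw [sf_comm, sf_sub_left, sf_comm n k x, sf_comm n k y]

theorem sf_zero_left (n k : ℕ) (z : Fin n → ℝ) : stdForm n k 0 z = 0 := by
  simp [stdForm]

/-- The standard form as a bilinear map. -/
noncomputable def sfBilin (n k : ℕ) : (Fin n → ℝ) →ₗ[ℝ] (Fin n → ℝ) →ₗ[ℝ] ℝ :=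
  LinearMap.mk₂ ℝ (stdForm n k) (sf_add_left n k) (sf_smul_left n k)
    (fun z x y => sf_add_right n k x y z) (fun c z x => sf_smul_right n k c x z)

/-- Reflection in the hyperplane orthogonal to `u`, as a matrix. -/
noncomputable def reflMat (n k : ℕ) (u : Fin n → ℝ) : Matrix (Fin n) (Fin n) ℝ :=
  1 - (2 / stdForm n k u u) •
    Matrix.vecMulVec u (fun i : Fin n => (if (i : ℕ) < k then (-1 : ℝ) else 1) * u i)

theorem reflMat_mulVec (n k : ℕ) (u x : Fin n → ℝ) :
    (reflMat n k u).mulVec x = x - (2 / stdForm n k u u * stdForm n k u x) • u := by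
  rw [reflMat, Matrix.sub_mulVec, Matrix.one_mulVec, Matrix.smul_mulVec,
    Matrix.vecMulVec_mulVec]
  ext i
  simp only [stdForm, dotProduct, Pi.sub_apply, Pi.smul_apply, smul_eq_mul,
    MulOpposite.smul_eq_mul_unop, MulOpposite.unop_op]
  ring

theorem reflMat_mem (n k : ℕ) (u : Fin n → ℝ) (hu : stdForm n k u u ≠ 0) :
    reflMat n k u ∈ indefOrthogonalGroup n k := by
  intro x y
  simp only [reflMat_mulVec, sf_sub_left, sf_sub_right, sf_smul_left, sf_smul_right]
  rw [sf_comm n k x u]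
  field_simp
  ring

theorem mul_mem_O {n k : ℕ} {A B : Matrix (Fin n) (Fin n) ℝ}
    (hA : A ∈ indefOrthogonalGroup n k) (hB : B ∈ indefOrthogonalGroup n k) :
    A * B ∈ indefOrthogonalGroup n k := by
  intro x y
  rw [← Matrix.mulVec_mulVec, ← Matrix.mulVec_mulVec, hA, hB]

theorem one_mem_O (n k : ℕ) : (1 : Matrix (Fin n) (Fin n) ℝ) ∈ indefOrthogonalGroup n k := by
  intro x y
  simp

theorem mul_mem_cc {n k : ℕ} {A B : Matrix (Fin n) (Fin n) ℝ}
    (hA : A ∈ connectedComponentIn (indefOrthogonalGroup n k) 1)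
    (hB : B ∈ connectedComponentIn (indefOrthogonalGroup n k) 1) :
    A * B ∈ connectedComponentIn (indefOrthogonalGroup n k) 1 := by
  have hAO := connectedComponentIn_subset _ _ hA
  have hpre : IsPreconnected ((fun X => A * X) ''
      connectedComponentIn (indefOrthogonalGroup n k) 1) :=
    isPreconnected_connectedComponentIn.image _ (by fun_prop)
  have hsub : ((fun X => A * X) '' connectedComponentIn (indefOrthogonalGroup n k) 1) ⊆
      connectedComponentIn (indefOrthogonalGroup n k) A := by
    refine hpre.subset_connectedComponentIn ⟨1, ?_, by simp⟩ ?_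
    · exact mem_connectedComponentIn (one_mem_O n k)
    · rintro _ ⟨X, hX, rfl⟩
      exact mul_mem_O hAO (connectedComponentIn_subset _ _ hX)
  rw [connectedComponentIn_eq hA]
  exact hsub ⟨B, hB, rfl⟩

theorem reflMat_sq (n k : ℕ) (u : Fin n → ℝ) (hu : stdForm n k u u ≠ 0) :
    reflMat n k u * reflMat n k u = 1 := by
  apply Matrix.ext_of_mulVec_single
  intro i
  rw [← Matrix.mulVec_mulVec, reflMat_mulVec, reflMat_mulVec, Matrix.one_mulVec, sf_sub_right,
    sf_smul_right, sub_sub, ← add_smul]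
  have : 2 / stdForm n k u u * stdForm n k u (Pi.single i 1) +
      2 / stdForm n k u u * (stdForm n k u (Pi.single i 1) -
        2 / stdForm n k u u * stdForm n k u (Pi.single i 1) * stdForm n k u u) = 0 := by
    field_simp
    ring
  rw [this]; simp

theorem refl_mul_mem_cc (n k : ℕ) (v w : Fin n → ℝ) (hv : stdForm n k v v = -1)
    (hw : stdForm n k w w = -1) (hvw : stdForm n k v w ≤ 0) :
    reflMat n k (v + w) * reflMat n k v ∈
      connectedComponentIn (indefOrthogonalGroup n k) 1 := by
  have hneg : ∀ t ∈ Set.Icc (0:ℝ) 1, stdForm n k (v + t • w) (v + t • w) ≠ 0 := by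
    intro t ht
    simp only [sf_add_left, sf_add_right, sf_smul_left, sf_smul_right]
    rw [sf_comm n k w v, hv, hw]
    nlinarith [mul_nonneg ht.1 (neg_nonneg.2 hvw), sq_nonneg t]
  have hcont : ContinuousOn (fun t : ℝ => reflMat n k (v + t • w) * reflMat n k v)
      (Set.Icc (0:ℝ) 1) := by
    have h1 : Continuous fun t : ℝ => stdForm n k (v + t • w) (v + t • w) := by
      unfold stdForm
      simp only [Pi.add_apply, Pi.smul_apply]
      fun_prop
    have h2 : Continuous fun t : ℝ => Matrix.vecMulVec (v + t • w)
        (fun i : Fin n => (if (i : ℕ) < k then (-1 : ℝ) else 1) * (v + t • w) i) := by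
      apply Continuous.matrix_vecMulVec
      · fun_prop
      · simp only [Pi.add_apply, Pi.smul_apply]
        fun_prop
    have h3 : ContinuousOn (fun t : ℝ => reflMat n k (v + t • w)) (Set.Icc (0:ℝ) 1) := by
      unfold reflMat
      have h4 : ContinuousOn (fun t : ℝ => 2 / stdForm n k (v + t • w) (v + t • w))
          (Set.Icc (0:ℝ) 1) := continuousOn_const.div h1.continuousOn hneg
      exact continuousOn_const.sub (h4.smul h2.continuousOn)
    exact h3.mul continuousOn_const
  have hv0 : stdForm n k v v ≠ 0 := by rw [hv]; norm_num
  have hsub := (isPreconnected_Icc.image _ hcont).subset_connectedComponentIn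
    (F := indefOrthogonalGroup n k) (x := 1)
    ⟨0, by simp, by simpa using reflMat_sq n k v hv0⟩
    (by
      rintro _ ⟨t, ht, rfl⟩
      exact mul_mem_O (reflMat_mem n k _ (hneg t ht)) (reflMat_mem n k _ hv0))
  exact hsub ⟨1, by simp, by simp⟩

/-- In a negative definite subspace, a proper subspace has a unit normal vector. -/
theorem exists_unit_normal (n k : ℕ) (S I : Submodule ℝ (Fin n → ℝ))
    (hneg : ∀ x ∈ S, x ≠ 0 → stdForm n k x x < 0) (hIS : I < S) :
    ∃ v ∈ S, v ∉ I ∧ stdForm n k v v = -1 ∧ ∀ y ∈ I, stdForm n k v y = 0 := by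
  obtain ⟨x, hxS, hxI⟩ := SetLike.exists_of_lt hIS
  let f : I →ₗ[ℝ] Module.Dual ℝ I := (sfBilin n k).domRestrict₁₂ I I
  have hf : ∀ a b : I, f a b = stdForm n k a b := fun a b => rfl
  have hinj : Function.Injective f := by
    rw [← LinearMap.ker_eq_bot, LinearMap.ker_eq_bot']
    intro a ha
    by_contra hne
    have h1 := hneg a (hIS.le a.2) (by simpa using hne)
    rw [← hf, ha] at h1
    simp at h1
  have hsurj : Function.Surjective f :=
    (LinearMap.injective_iff_surjective_of_finrank_eq_finrank
      (Subspace.dual_finrank_eq (K := ℝ) (V := I)).symm).1 hinj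
  obtain ⟨p, hp⟩ := hsurj ((sfBilin n k x).domRestrict I)
  have hpo : ∀ y ∈ I, stdForm n k (x - p) y = 0 := by
    intro y hy
    have h2 : stdForm n k p y = stdForm n k x y := by
      have := LinearMap.congr_fun hp ⟨y, hy⟩
      exact this
    rw [sf_sub_left, h2, sub_self]
  have hzS : x - (p : Fin n → ℝ) ∈ S := S.sub_mem hxS (hIS.le p.2)
  have hzI : x - (p : Fin n → ℝ) ∉ I := fun h => hxI (by simpa using I.add_mem h p.2)
  set z := x - (p : Fin n → ℝ)
  have hz : stdForm n k z z < 0 := hneg z hzS (fun h => hzI (h ▸ I.zero_mem))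
  have hs : 0 < Real.sqrt (-stdForm n k z z) := Real.sqrt_pos.2 (by linarith)
  have hsq : Real.sqrt (-stdForm n k z z) * Real.sqrt (-stdForm n k z z) = -stdForm n k z z :=
    Real.mul_self_sqrt (by linarith)
  set s := Real.sqrt (-stdForm n k z z)
  refine ⟨s⁻¹ • z, S.smul_mem _ hzS, fun h => hzI ?_, ?_, ?_⟩
  · exact (I.smul_mem_iff (inv_ne_zero hs.ne')).1 h
  · rw [sf_smul_left, sf_smul_right, show stdForm n k z z = -(s * s) by linarith]
    field_simp
  · intro y hy
    rw [sf_smul_left, hpo y hy, mul_zero]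

theorem inj_of_mem_O {n k : ℕ} {A : Matrix (Fin n) (Fin n) ℝ}
    (hA : A ∈ indefOrthogonalGroup n k) : Function.Injective A.mulVecLin := by
  rw [← LinearMap.ker_eq_bot, LinearMap.ker_eq_bot']
  intro x hx
  ext i
  have h := hA x (Pi.single i 1)
  rw [show A *ᵥ x = 0 from hx, sf_zero_left] at h
  have h2 : stdForm n k x (Pi.single i 1) = (if (i : ℕ) < k then (-1 : ℝ) else 1) * x i := by
    simp [stdForm, Pi.single_apply]
  rw [h2] at h
  split_ifs at h <;> simpa using h.symm

theorem map_mem_negGr {n k : ℕ} {A : Matrix (Fin n) (Fin n) ℝ}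
    (hA : A ∈ indefOrthogonalGroup n k) {S : Submodule ℝ (Fin n → ℝ)}
    (hS : S ∈ negGrassmannian n k) : S.map A.mulVecLin ∈ negGrassmannian n k := by
  refine ⟨?_, ?_⟩
  · rw [← hS.1]
    exact (Submodule.equivMapOfInjective _ (inj_of_mem_O hA) S).finrank_eq.symm
  · rintro _ ⟨x, hx, rfl⟩ hne
    rw [Matrix.mulVecLin_apply, hA]
    exact hS.2 x hx (fun h => hne (by simp [h]))

theorem transitive_aux (n k : ℕ) (S₂ : Submodule ℝ (Fin n → ℝ)) (h₂ : S₂ ∈ negGrassmannian n k) :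
    ∀ (d : ℕ) (S₁ : Submodule ℝ (Fin n → ℝ)), S₁ ∈ negGrassmannian n k →
      k ≤ Module.finrank ℝ (S₁ ⊓ S₂ : Submodule ℝ (Fin n → ℝ)) + d →
      ∃ A ∈ connectedComponentIn (indefOrthogonalGroup n k) (1 : Matrix (Fin n) (Fin n) ℝ),
        Submodule.map (Matrix.mulVecLin A) S₁ = S₂ := by
  intro d
  induction d with
  | zero =>
    intro S₁ h₁ hd
    have e1 : S₁ ⊓ S₂ = S₁ := Submodule.eq_of_le_of_finrank_le inf_le_left (by rw [h₁.1]; exact hd)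
    have e2 : S₁ ⊓ S₂ = S₂ := Submodule.eq_of_le_of_finrank_le inf_le_right (by rw [h₂.1]; exact hd)
    refine ⟨1, mem_connectedComponentIn (one_mem_O n k), ?_⟩
    rw [Matrix.mulVecLin_one, Submodule.map_id, ← e1, e2]
  | succ d ih =>
    intro S₁ h₁ hd
    by_cases hlt : k ≤ Module.finrank ℝ (S₁ ⊓ S₂ : Submodule ℝ (Fin n → ℝ)) + d
    · exact ih S₁ h₁ hlt
    have hk : Module.finrank ℝ (S₁ ⊓ S₂ : Submodule ℝ (Fin n → ℝ)) < k := by omega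
    have hl1 : S₁ ⊓ S₂ < S₁ := lt_of_le_of_ne inf_le_left (fun h => by
      rw [h, h₁.1] at hk; exact lt_irrefl _ hk)
    have hl2 : S₁ ⊓ S₂ < S₂ := lt_of_le_of_ne inf_le_right (fun h => by
      rw [h, h₂.1] at hk; exact lt_irrefl _ hk)
    obtain ⟨v, hvS, hvI, hv, hvo⟩ := exists_unit_normal n k _ _ h₁.2 hl1
    obtain ⟨w, hwS, hwI, hw, hwo, hvw⟩ : ∃ w ∈ S₂, w ∉ S₁ ⊓ S₂ ∧ stdForm n k w w = -1 ∧
        (∀ y ∈ S₁ ⊓ S₂, stdForm n k w y = 0) ∧ stdForm n k v w ≤ 0 := by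
      obtain ⟨w, hwS, hwI, hw, hwo⟩ := exists_unit_normal n k _ _ h₂.2 hl2
      rcases le_total (stdForm n k v w) 0 with h | h
      · exact ⟨w, hwS, hwI, hw, hwo, h⟩
      · refine ⟨(-1 : ℝ) • w, S₂.smul_mem _ hwS, fun h => hwI ?_, ?_, ?_, ?_⟩
        · exact (Submodule.smul_mem_iff _ (by norm_num)).1 h
        · rw [sf_smul_left, sf_smul_right, hw]; norm_num
        · intro y hy
          rw [sf_smul_left, hwo y hy, mul_zero]
        · rw [sf_smul_right]; linarith
    have hAcc := refl_mul_mem_cc n k v w hv hw hvw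
    have hAv : (reflMat n k (v + w) * reflMat n k v) *ᵥ v = w := by
      have hden : -1 + stdForm n k v w ≠ 0 := by linarith
      have e1 : reflMat n k v *ᵥ v = (-1 : ℝ) • v := by
        rw [reflMat_mulVec, hv]
        ext i; simp; ring
      have e2 : stdForm n k (v + w) (v + w) = 2 * (-1 + stdForm n k v w) := by
        simp only [sf_add_left, sf_add_right]
        rw [sf_comm n k w v, hv, hw]; ring
      have e3 : stdForm n k (v + w) v = -1 + stdForm n k v w := by
        rw [sf_add_left, sf_comm n k w v, hv]
      rw [← Matrix.mulVec_mulVec, e1, Matrix.mulVec_smul, reflMat_mulVec, e2, e3]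
      have e4 : 2 / (2 * (-1 + stdForm n k v w)) * (-1 + stdForm n k v w) = 1 := by
        field_simp
      rw [e4]
      ext i; simp
    have hAI : ∀ y ∈ S₁ ⊓ S₂, (reflMat n k (v + w) * reflMat n k v) *ᵥ y = y := by
      intro y hy
      have e1 : reflMat n k v *ᵥ y = y := by
        rw [reflMat_mulVec, hvo y hy]; simp
      rw [← Matrix.mulVec_mulVec, e1, reflMat_mulVec, sf_add_left n k v w y, hvo y hy, hwo y hy]
      simp
    set A := reflMat n k (v + w) * reflMat n k v
    have hAO := connectedComponentIn_subset _ _ hAcc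
    have hgt : S₁ ⊓ S₂ < S₁.map A.mulVecLin ⊓ S₂ := by
      refine lt_of_le_of_ne (fun y hy => ⟨⟨y, hy.1, hAI y hy⟩, hy.2⟩) (fun h => hwI ?_)
      rw [h]
      exact ⟨⟨v, hvS, hAv⟩, hwS⟩
    have hfr := Submodule.finrank_lt_finrank_of_lt hgt
    obtain ⟨B, hB, hBm⟩ := ih _ (map_mem_negGr hAO h₁) (by omega)
    refine ⟨B * A, mul_mem_cc hB hAcc, ?_⟩
    rw [Matrix.mulVecLin_mul, Submodule.map_comp, hBm]

/-- **Transitivity of the identity component of `O(n,k)` on the negative Grassmannian.**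
For `0 < k < n`, the connected component of the identity in `O(n,k)` acts transitively on
`G_k⁻(n)`; in particular `G_k⁻(n)` is connected. -/
theorem identity_component_transitive_on_negGrassmannian
    (n k : ℕ) (hk0 : 0 < k) (hkn : k < n) :
    ∀ S₁ ∈ negGrassmannian n k, ∀ S₂ ∈ negGrassmannian n k,
      ∃ A ∈ connectedComponentIn (indefOrthogonalGroup n k)
          (1 : Matrix (Fin n) (Fin n) ℝ),
        Submodule.map (Matrix.mulVecLin A) S₁ = S₂ := by
  intro S₁ h₁ S₂ h₂
  exact transitive_aux n k S₂ h₂ k S₁ h₁ (by omega)
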